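/- arXiv:1605.02302 — 4 statements merged into one kernel-verified Lean document; each statement's English description precedes it below -/
import Mathlib

section
/- Let n ≥ 1 be an integer and let L_n = U³ ⊕ ⟨−2(n+1)⟩ with δ the generator of the rank-one summand. For every primitive vector h ∈ L_n, setting t = div(h), there exist a sign ε ∈ {1, −1}, an isometry g of L_n of determinant ε which induces multiplication by ε on the discriminant group A_{L_n}, a primitive vector H of the U³ summand, and an integer β with 0 ≤ β ≤ n+1, such that, setting m = gcd(β, 2n+2), one has g(h) = t·H − (β/m)·δ. (This is the lattice-theoretic content of Lemma 4.1/Theorem 4.2: every primitive class in the second cohomology lattice of a generalized Kummer variety can be brought into the normal form t·h_A − (β/m)·δ by an isometry g with det(g)·χ(g) = 1, i.e. by a monodromy operator.) -/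
/-- The Beauville–Bogomolov lattice `L_n = U³ ⊕ ⟨-2(n+1)⟩` realized on `Fin 7 → ℤ`:
coordinates (0,1), (2,3), (4,5) span three hyperbolic planes and coordinate 6 spans
the rank-one summand of square `-2(n+1)`. -/
def Bn (n : ℕ) (x y : Fin 7 → ℤ) : ℤ :=
  x 0 * y 1 + x 1 * y 0 + x 2 * y 3 + x 3 * y 2 + x 4 * y 5 + x 5 * y 4
    - (2 * (n : ℤ) + 2) * (x 6 * y 6)

/-- The generator `δ` of the rank-one summand `⟨-2(n+1)⟩` of `L_n`. -/
def deltaLn : Fin 7 → ℤ := fun i => if i = 6 then 1 else 0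

/-- A vector of a `ℤ`-module is primitive if it is not a nontrivial integer multiple. -/
def IsPrimitiveVec {M : Type*} [AddCommGroup M] [Module ℤ M] (v : M) : Prop :=
  ∀ (m : ℤ) (w : M), v = m • w → IsUnit m

/-- `t` is the divisibility `div(h)` of `h` in `L_n`: the positive generator of the
ideal `B(h, L_n) ⊆ ℤ`. -/
def IsDivisibilityOf (n : ℕ) (t : ℕ) (h : Fin 7 → ℤ) : Prop :=
  0 < t ∧ (∀ y, (t : ℤ) ∣ Bn n h y) ∧ ∀ s : ℤ, (∀ y, s ∣ Bn n h y) → s ∣ (t : ℤ)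

/-- `y` is the image of `x` under an isometry of `L_n` of determinant one which acts trivially on
the discriminant group. -/
def StablyEquivalent (n : ℕ) (x y : Fin 7 → ℤ) : Prop :=
  ∃ g : (Fin 7 → ℤ) ≃ₗ[ℤ] (Fin 7 → ℤ),
    (∀ x y, Bn n (g x) (g y) = Bn n x y) ∧
    LinearMap.det g.toLinearMap = 1 ∧
    (∀ φ : Module.Dual ℤ (Fin 7 → ℤ), ∃ w, ∀ y, φ (g y) - φ y = Bn n w y) ∧
    g x = y

theorem Bn_comm (n : ℕ) (x y : Fin 7 → ℤ) : Bn n x y = Bn n y x := by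
  simp only [Bn]; ring

theorem Bn_add_left (n : ℕ) (x y z : Fin 7 → ℤ) : Bn n (x + y) z = Bn n x z + Bn n y z := by
  simp only [Bn, Pi.add_apply]; ring

theorem Bn_smul_left (n : ℕ) (c : ℤ) (x z : Fin 7 → ℤ) : Bn n (c • x) z = c * Bn n x z := by
  simp only [Bn, Pi.smul_apply, smul_eq_mul]; ring

theorem Bn_add_right (n : ℕ) (x y z : Fin 7 → ℤ) : Bn n z (x + y) = Bn n z x + Bn n z y := by
  simp only [Bn, Pi.add_apply]; ring

theorem Bn_smul_right (n : ℕ) (c : ℤ) (x z : Fin 7 → ℤ) : Bn n z (c • x) = c * Bn n z x := by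
  simp only [Bn, Pi.smul_apply, smul_eq_mul]; ring

/-- The functional `B(·, v)`. -/
def pairingWith (n : ℕ) (v : Fin 7 → ℤ) : (Fin 7 → ℤ) →ₗ[ℤ] ℤ where
  toFun x := Bn n x v
  map_add' x y := Bn_add_left n x y v
  map_smul' c x := Bn_smul_left n c x v

theorem StablyEquivalent.trans {n : ℕ} {x y z : Fin 7 → ℤ}
    (hxy : StablyEquivalent n x y) (hyz : StablyEquivalent n y z) : StablyEquivalent n x z := by
  obtain ⟨g, hg, hdet, hdisc, rfl⟩ := hxy
  obtain ⟨k, hk, kdet, kdisc, rfl⟩ := hyz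
  refine ⟨g.trans k, fun x y => by simp [hk, hg], ?_, fun φ => ?_, rfl⟩
  · rw [LinearEquiv.coe_trans, LinearMap.det_comp, hdet, kdet, one_mul]
  · obtain ⟨v, hv⟩ := hdisc (φ ∘ₗ k.toLinearMap)
    obtain ⟨w, hw⟩ := kdisc φ
    refine ⟨v + w, fun y => ?_⟩
    have h₁ := hv y
    have h₂ := hw y
    simp only [LinearMap.comp_apply, LinearEquiv.coe_coe] at h₁
    rw [Bn_add_left, LinearEquiv.trans_apply]
    linarith

theorem StablyEquivalent.refl (n : ℕ) (x : Fin 7 → ℤ) : StablyEquivalent n x x :=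
  ⟨LinearEquiv.refl ℤ _, fun _ _ => rfl, LinearMap.det_id, fun φ => ⟨0, by simp [Bn]⟩, rfl⟩

theorem StablyEquivalent.isPrimitiveVec {n : ℕ} {x y : Fin 7 → ℤ}
    (hxy : StablyEquivalent n x y) (hx : IsPrimitiveVec x) : IsPrimitiveVec y := by
  obtain ⟨g, -, -, -, rfl⟩ := hxy
  intro m w hw
  refine hx m (g.symm w) ?_
  rw [← map_smul, ← hw, g.symm_apply_apply]

theorem StablyEquivalent.isDivisibilityOf {n t : ℕ} {x y : Fin 7 → ℤ}
    (hxy : StablyEquivalent n x y) (hx : IsDivisibilityOf n t x) : IsDivisibilityOf n t y := by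
  obtain ⟨g, hg, -, -, rfl⟩ := hxy
  refine ⟨hx.1, fun z => ?_, fun s hs => hx.2.2 s fun z => ?_⟩
  · rw [← g.apply_symm_apply z, hg]
    exact hx.2.1 _
  · rw [← hg]
    exact hs _

theorem LinearMap.det_id_add_of_isNilpotent {R M : Type*} [CommRing R] [IsDomain R]
    [AddCommGroup M] [Module R M] [Module.Finite R M] [Module.Free R M]
    {N : Module.End R M} (hN : IsNilpotent N) : LinearMap.det (LinearMap.id + N) = 1 := by
  have hneg : IsNilpotent (-N) := hN.neg
  have h := LinearMap.eval_charpoly (-N) 1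
  rw [hneg.charpoly_eq_X_pow_finrank] at h
  simpa [Module.End.one_eq_id] using h.symm

/-- The difference between the Eichler transvection attached to `e, w` and the identity, where
`s` is half the square of `w`. -/
def transvectionDiff (n : ℕ) (e w : Fin 7 → ℤ) (s : ℤ) : Module.End ℤ (Fin 7 → ℤ) :=
  (pairingWith n e).smulRight (w - s • e) - (pairingWith n w).smulRight e

theorem transvectionDiff_apply (n : ℕ) (e w : Fin 7 → ℤ) (s : ℤ) (x : Fin 7 → ℤ) :
    transvectionDiff n e w s x = Bn n x e • w + (-(s * Bn n x e) - Bn n x w) • e := by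
  simp only [transvectionDiff, LinearMap.sub_apply, LinearMap.smulRight_apply, pairingWith,
    LinearMap.coe_mk, AddHom.coe_mk]
  module

/-- Eichler transvections are isometries of determinant one acting trivially on the discriminant
group. -/
theorem stablyEquivalent_transvection (n : ℕ) (e w : Fin 7 → ℤ) (s : ℤ)
    (hee : Bn n e e = 0) (hew : Bn n e w = 0) (hww : Bn n w w = 2 * s) (x : Fin 7 → ℤ) :
    StablyEquivalent n x (x + (Bn n x e • w + (-(s * Bn n x e) - Bn n x w) • e)) := by
  have hwe : Bn n w e = 0 := by rw [Bn_comm, hew]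
  have inv (v : Fin 7 → ℤ) (hev : Bn n e v = 0) (hvv : Bn n v v = 2 * s) :
      (LinearMap.id + transvectionDiff n e v s) ∘ₗ (LinearMap.id + transvectionDiff n e (-v) s)
        = LinearMap.id := by
    have hve : Bn n v e = 0 := by rw [Bn_comm, hev]
    refine LinearMap.ext fun y => ?_
    have hneg : -v = (-1 : ℤ) • v := by simp
    simp only [LinearMap.comp_apply, LinearMap.add_apply, LinearMap.id_apply,
      transvectionDiff_apply, hneg, Bn_add_left, Bn_smul_left, Bn_smul_right, hee, hev, hve, hvv]
    module
  have hnegneg := inv (-w)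
    (by rw [← neg_one_smul ℤ w, Bn_smul_right, hew, mul_zero])
    (by rw [← neg_one_smul ℤ w, Bn_smul_right, Bn_smul_left, hww]; ring)
  rw [neg_neg] at hnegneg
  have hnil : IsNilpotent (transvectionDiff n e w s) := by
    refine ⟨3, LinearMap.ext fun y => ?_⟩
    simp only [pow_succ, pow_zero, one_mul, Module.End.mul_apply, transvectionDiff_apply,
      Bn_add_left, Bn_smul_left, hee, hew, hwe, hww, LinearMap.zero_apply]
    module
  refine ⟨LinearEquiv.ofLinearMap (LinearMap.id + transvectionDiff n e w s)
    (LinearMap.id + transvectionDiff n e (-w) s) (inv w hew hww) hnegneg, fun y z => ?_, ?_,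
    fun φ => ⟨(φ w - s * φ e) • e + (-φ e) • w, fun y => ?_⟩, ?_⟩
  · simp only [LinearEquiv.coe_ofLinearMap, LinearMap.add_apply, LinearMap.id_apply,
      transvectionDiff_apply, Bn_add_left, Bn_smul_left, Bn_add_right, Bn_smul_right, hee, hew,
      hwe, hww, Bn_comm n e z, Bn_comm n w z]
    ring
  · exact LinearMap.det_id_add_of_isNilpotent hnil
  · simp only [LinearEquiv.coe_ofLinearMap, LinearMap.add_apply, LinearMap.id_apply,
      transvectionDiff_apply, Bn_add_left, Bn_smul_left, map_add, map_smul, smul_eq_mul,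
      Bn_comm n e y, Bn_comm n w y]
    ring
  · simp only [LinearEquiv.coe_ofLinearMap, LinearMap.add_apply, LinearMap.id_apply,
      transvectionDiff_apply]

/-- Smith normal form for the integral matrices with rows `(p, -r)` and `(s, q)`, phrased as an
induction principle over elementary row and column operations. -/
theorem smith_induction {P : ℤ → ℤ → ℤ → ℤ → Prop}
    (base : ∀ k m, P k (k * m) 0 0)
    (m02 : ∀ c p q r s, P (p - c * s) q (r + c * q) s → P p q r s)
    (m03 : ∀ c p q r s, P (p - c * r) q r (s + c * q) → P p q r s)
    (m12 : ∀ c p q r s, P p (q - c * s) (r + c * p) s → P p q r s)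
    (m13 : ∀ c p q r s, P p (q - c * r) r (s + c * p) → P p q r s)
    (p q r s : ℤ) : P p q r s := by
  have main : ∀ N : ℕ, ∀ p q r s : ℤ, p ≠ 0 → p.natAbs = N → P p q r s := by
    intro N
    induction N using Nat.strong_induction_on with
    | _ N ih =>
    intro p q r s hp hN
    have bound (u : ℤ) (hu : ¬ p ∣ u) :
        p - ((p - 1) / (u % p)) * (u % p) ≠ 0 ∧
          (p - ((p - 1) / (u % p)) * (u % p)).natAbs < N := by
      have h₀ : u % p ≠ 0 := fun h => hu (Int.dvd_of_emod_eq_zero h)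
      have h₁ := Int.emod_nonneg u hp
      have h₂ := Int.emod_lt_abs u hp
      have h₃ := Int.emod_nonneg (p - 1) h₀
      have h₄ := Int.emod_lt_of_pos (p - 1) (lt_of_le_of_ne h₁ (Ne.symm h₀))
      have h₅ := Int.mul_ediv_add_emod (p - 1) (u % p)
      rw [mul_comm] at h₅
      rw [Int.abs_eq_natAbs] at h₂
      omega
    have reduce (u : ℤ) : u + -(u / p) * p = u % p := by
      have := Int.mul_ediv_add_emod u p
      linarith
    have caseR (q r s : ℤ) (hr : ¬ p ∣ r) : P p q r s := by
      refine m12 (-(r / p)) p q r s ?_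
      rw [reduce]
      obtain ⟨h₁, h₂⟩ := bound r hr
      exact m03 _ _ _ _ _ (ih _ h₂ _ _ _ _ h₁ rfl)
    have caseS (q r s : ℤ) (hs : ¬ p ∣ s) : P p q r s := by
      refine m13 (-(s / p)) p q r s ?_
      rw [reduce]
      obtain ⟨h₁, h₂⟩ := bound s hs
      exact m02 _ _ _ _ _ (ih _ h₂ _ _ _ _ h₁ rfl)
    by_cases hr : p ∣ r
    swap
    · exact caseR _ _ _ hr
    by_cases hs : p ∣ s
    swap
    · exact caseS _ _ _ hs
    refine m12 (-(r / p)) p q r s ?_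
    rw [reduce, Int.emod_eq_zero_of_dvd hr]
    refine m13 (-(s / p)) _ _ _ _ ?_
    rw [reduce, Int.emod_eq_zero_of_dvd hs]
    generalize q - -(r / p) * s - -(s / p) * 0 = q'
    by_cases hq : p ∣ q'
    · obtain ⟨m, rfl⟩ := hq
      exact base p m
    · refine m02 1 _ _ _ _ ?_
      rw [mul_zero, sub_zero, zero_add, one_mul]
      exact caseR _ _ _ hq
  have nonzeroR (p q r s : ℤ) (hr : r ≠ 0) : P p q r s := by
    by_cases hp : p = 0
    · exact m03 (-1) _ _ _ _ (main _ _ _ _ _ (by simpa [hp] using hr) rfl)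
    · exact main _ _ _ _ _ hp rfl
  by_cases hr : r = 0
  swap
  · exact nonzeroR _ _ _ _ hr
  by_cases hp : p = 0
  swap
  · exact main _ _ _ _ _ hp rfl
  by_cases hs : s = 0
  swap
  · exact m02 (-1) _ _ _ _ (main _ _ _ _ _ (by simpa [hp] using hs) rfl)
  by_cases hq : q = 0
  swap
  · exact m02 1 _ _ _ _ (nonzeroR _ _ _ _ (by simpa [hr] using hq))
  subst hr hp hs hq
  simpa using base 0 0

/-- Inside the first two hyperbolic planes every vector can be moved into the first plane, to a
multiple of a vector with first coordinate one. -/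
theorem reduce_planes_one_two (n : ℕ) (u v a p q r s : ℤ) :
    ∃ k m, StablyEquivalent n ![p, q, r, s, u, v, a] ![k, k * m, 0, 0, u, v, a] ∧
      k ∣ p ∧ k ∣ q ∧ k ∣ r ∧ k ∣ s := by
  refine smith_induction
    (P := fun p q r s => ∃ k m, StablyEquivalent n ![p, q, r, s, u, v, a]
      ![k, k * m, 0, 0, u, v, a] ∧ k ∣ p ∧ k ∣ q ∧ k ∣ r ∧ k ∣ s)
    (fun k m => ⟨k, m, .refl _ _, by simp⟩) ?_ ?_ ?_ ?_ p q r s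
  · rintro c p q r s ⟨k, m, hk, hp, hq, hr, hs⟩
    refine ⟨k, m, .trans ?_ hk, ?_, hq, ?_, hs⟩
    · convert stablyEquivalent_transvection n ![1, 0, 0, 0, 0, 0, 0] ![0, 0, c, 0, 0, 0, 0] 0
        (by simp [Bn]) (by simp [Bn]) (by simp [Bn]) ![p, q, r, s, u, v, a] using 1
      ext i; fin_cases i <;> simp [Bn] <;> ring
    · exact (dvd_sub_left (hs.mul_left c)).mp hp
    · exact (dvd_add_left (hq.mul_left c)).mp hr
  · rintro c p q r s ⟨k, m, hk, hp, hq, hr, hs⟩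
    refine ⟨k, m, .trans ?_ hk, ?_, hq, hr, ?_⟩
    · convert stablyEquivalent_transvection n ![1, 0, 0, 0, 0, 0, 0] ![0, 0, 0, c, 0, 0, 0] 0
        (by simp [Bn]) (by simp [Bn]) (by simp [Bn]) ![p, q, r, s, u, v, a] using 1
      ext i; fin_cases i <;> simp [Bn] <;> ring
    · exact (dvd_sub_left (hr.mul_left c)).mp hp
    · exact (dvd_add_left (hq.mul_left c)).mp hs
  · rintro c p q r s ⟨k, m, hk, hp, hq, hr, hs⟩
    refine ⟨k, m, .trans ?_ hk, hp, ?_, ?_, hs⟩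
    · convert stablyEquivalent_transvection n ![0, 1, 0, 0, 0, 0, 0] ![0, 0, c, 0, 0, 0, 0] 0
        (by simp [Bn]) (by simp [Bn]) (by simp [Bn]) ![p, q, r, s, u, v, a] using 1
      ext i; fin_cases i <;> simp [Bn] <;> ring
    · exact (dvd_sub_left (hs.mul_left c)).mp hq
    · exact (dvd_add_left (hp.mul_left c)).mp hr
  · rintro c p q r s ⟨k, m, hk, hp, hq, hr, hs⟩
    refine ⟨k, m, .trans ?_ hk, hp, ?_, hr, ?_⟩
    · convert stablyEquivalent_transvection n ![0, 1, 0, 0, 0, 0, 0] ![0, 0, 0, c, 0, 0, 0] 0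
        (by simp [Bn]) (by simp [Bn]) (by simp [Bn]) ![p, q, r, s, u, v, a] using 1
      ext i; fin_cases i <;> simp [Bn] <;> ring
    · exact (dvd_sub_left (hr.mul_left c)).mp hq
    · exact (dvd_add_left (hp.mul_left c)).mp hs

/-- Inside the last two hyperbolic planes every vector can be moved into the second plane. -/
theorem reduce_planes_two_three (n : ℕ) (u v a p q r s : ℤ) :
    ∃ k m, StablyEquivalent n ![u, v, p, q, r, s, a] ![u, v, k, k * m, 0, 0, a] ∧
      k ∣ p ∧ k ∣ q ∧ k ∣ r ∧ k ∣ s := by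
  refine smith_induction
    (P := fun p q r s => ∃ k m, StablyEquivalent n ![u, v, p, q, r, s, a]
      ![u, v, k, k * m, 0, 0, a] ∧ k ∣ p ∧ k ∣ q ∧ k ∣ r ∧ k ∣ s)
    (fun k m => ⟨k, m, .refl _ _, by simp⟩) ?_ ?_ ?_ ?_ p q r s
  · rintro c p q r s ⟨k, m, hk, hp, hq, hr, hs⟩
    refine ⟨k, m, .trans ?_ hk, ?_, hq, ?_, hs⟩
    · convert stablyEquivalent_transvection n ![0, 0, 1, 0, 0, 0, 0] ![0, 0, 0, 0, c, 0, 0] 0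
        (by simp [Bn]) (by simp [Bn]) (by simp [Bn]) ![u, v, p, q, r, s, a] using 1
      ext i; fin_cases i <;> simp [Bn] <;> ring
    · exact (dvd_sub_left (hs.mul_left c)).mp hp
    · exact (dvd_add_left (hq.mul_left c)).mp hr
  · rintro c p q r s ⟨k, m, hk, hp, hq, hr, hs⟩
    refine ⟨k, m, .trans ?_ hk, ?_, hq, hr, ?_⟩
    · convert stablyEquivalent_transvection n ![0, 0, 1, 0, 0, 0, 0] ![0, 0, 0, 0, 0, c, 0] 0
        (by simp [Bn]) (by simp [Bn]) (by simp [Bn]) ![u, v, p, q, r, s, a] using 1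
      ext i; fin_cases i <;> simp [Bn] <;> ring
    · exact (dvd_sub_left (hr.mul_left c)).mp hp
    · exact (dvd_add_left (hq.mul_left c)).mp hs
  · rintro c p q r s ⟨k, m, hk, hp, hq, hr, hs⟩
    refine ⟨k, m, .trans ?_ hk, hp, ?_, ?_, hs⟩
    · convert stablyEquivalent_transvection n ![0, 0, 0, 1, 0, 0, 0] ![0, 0, 0, 0, c, 0, 0] 0
        (by simp [Bn]) (by simp [Bn]) (by simp [Bn]) ![u, v, p, q, r, s, a] using 1
      ext i; fin_cases i <;> simp [Bn] <;> ring
    · exact (dvd_sub_left (hs.mul_left c)).mp hq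
    · exact (dvd_add_left (hp.mul_left c)).mp hr
  · rintro c p q r s ⟨k, m, hk, hp, hq, hr, hs⟩
    refine ⟨k, m, .trans ?_ hk, hp, ?_, hr, ?_⟩
    · convert stablyEquivalent_transvection n ![0, 0, 0, 1, 0, 0, 0] ![0, 0, 0, 0, 0, c, 0] 0
        (by simp [Bn]) (by simp [Bn]) (by simp [Bn]) ![u, v, p, q, r, s, a] using 1
      ext i; fin_cases i <;> simp [Bn] <;> ring
    · exact (dvd_sub_left (hr.mul_left c)).mp hq
    · exact (dvd_add_left (hp.mul_left c)).mp hs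

/-- The `U³` component of a vector can be moved into the first plane. -/
theorem exists_stablyEquivalent_first_plane (n : ℕ) (p q r s u v a : ℤ) :
    ∃ k m, StablyEquivalent n ![p, q, r, s, u, v, a] ![k, k * m, 0, 0, 0, 0, a] ∧
      k ∣ p ∧ k ∣ q ∧ k ∣ r := by
  obtain ⟨k₁, m₁, h₁, hr, -⟩ := reduce_planes_two_three n p q a r s u v
  obtain ⟨k, m, h, hp, hq, hk, -⟩ := reduce_planes_one_two n 0 0 a p q k₁ (k₁ * m₁)
  exact ⟨k, m, h₁.trans h, hp, hq, hk.trans hr⟩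

/-- A primitive vector of divisibility `t` is stably equivalent to one whose `U³` component is
`t` times a primitive vector of the first plane. -/
theorem exists_stablyEquivalent_divisibility {n t : ℕ} {h : Fin 7 → ℤ}
    (hprim : IsPrimitiveVec h) (ht : IsDivisibilityOf n t h) :
    ∃ σ m a : ℤ, IsUnit σ ∧ IsCoprime (t : ℤ) a ∧ (t : ℤ) ∣ 2 * n + 2 ∧
      StablyEquivalent n h ![t * σ, t * m, 0, 0, 0, 0, a] := by
  obtain ⟨k₁, m₁, e₁, -⟩ :=
    exists_stablyEquivalent_first_plane n (h 0) (h 1) (h 2) (h 3) (h 4) (h 5) (h 6)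
  generalize ha : h 6 = a at e₁
  have hh : ![h 0, h 1, h 2, h 3, h 4, h 5, a] = h := by
    ext i; fin_cases i <;> simp [ha]
  rw [hh] at e₁
  have e₂ : StablyEquivalent n ![k₁, k₁ * m₁, 0, 0, 0, 0, a]
      ![k₁, k₁ * m₁, (2 * n + 2) * a, 0, 0, 0, a] := by
    convert stablyEquivalent_transvection n ![0, 0, 1, 0, 0, 0, 0] ![0, 0, 0, 0, 0, 0, 1] (-(n + 1))
      (by simp [Bn]) (by simp [Bn]) (by simp [Bn]; ring) ![k₁, k₁ * m₁, 0, 0, 0, 0, a] using 1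
    ext i; fin_cases i <;> simp [Bn]
  obtain ⟨k, m, e₃, hk₁, -, hka⟩ :=
    exists_stablyEquivalent_first_plane n k₁ (k₁ * m₁) ((2 * n + 2) * a) 0 0 0 a
  have e := (e₁.trans e₂).trans e₃
  have hkt : k ∣ t := by
    refine (e₁.isDivisibilityOf ht).2.2 k fun y => ?_
    have : Bn n ![k₁, k₁ * m₁, 0, 0, 0, 0, a] y
        = k₁ * (y 1 + m₁ * y 0) - (2 * n + 2) * a * y 6 := by
      simp [Bn]; ring
    rw [this]
    exact dvd_sub (hk₁.mul_right _) (hka.mul_right _)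
  have hdiv := (e.isDivisibilityOf ht).2.1
  have htk : (t : ℤ) ∣ k := by
    simpa [Bn] using hdiv ![0, 1, 0, 0, 0, 0, 0]
  have hta : (t : ℤ) ∣ (2 * n + 2) * a := by
    simpa [Bn] using hdiv ![0, 0, 0, 0, 0, 0, 1]
  have hcop : IsCoprime (t : ℤ) a := by
    rw [Int.isCoprime_iff_gcd_eq_one]
    obtain ⟨b, hb⟩ := (Int.gcd_dvd_left (t : ℤ) a).trans htk
    obtain ⟨c, hc⟩ := Int.gcd_dvd_right (t : ℤ) a
    have hu := e.isPrimitiveVec hprim (Int.gcd (t : ℤ) a) ![b, b * m, 0, 0, 0, 0, c] (by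
      generalize (Int.gcd (t : ℤ) a : ℤ) = d at hb hc
      subst hb hc
      ext i; fin_cases i <;> simp [mul_assoc])
    simpa [Int.isUnit_iff_natAbs_eq] using hu
  obtain ⟨σ, hσ⟩ := htk
  have ht0 : (t : ℤ) ≠ 0 := by exact_mod_cast ht.1.ne'
  refine ⟨σ, σ * m, a, ?_, hcop, hcop.dvd_of_dvd_mul_right hta, ?_⟩
  · obtain ⟨τ, hτ⟩ := hkt
    refine IsUnit.of_mul_eq_one τ (mul_left_cancel₀ ht0 ?_)
    rw [← mul_assoc, ← hσ, ← hτ, mul_one]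
  · rwa [hσ, mul_assoc] at e

/-- The `δ` coordinate can be changed by multiples of the divisibility. -/
theorem exists_stablyEquivalent_shift (n : ℕ) {t σ m a a' : ℤ} (hσ : IsUnit σ)
    (htd : t ∣ 2 * n + 2) (haa' : t ∣ a' - a) :
    ∃ m', StablyEquivalent n ![t * σ, t * m, 0, 0, 0, 0, a] ![t * σ, t * m', 0, 0, 0, 0, a'] := by
  obtain ⟨j, hj⟩ := haa'
  obtain ⟨d, hd⟩ := htd
  have hσσ : σ * σ = 1 := Int.isUnit_mul_self hσ
  refine ⟨m + d * (a * (σ * j)) + (n + 1) * j * j * σ, ?_⟩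
  convert stablyEquivalent_transvection n ![0, 1, 0, 0, 0, 0, 0] ![0, 0, 0, 0, 0, 0, σ * j]
    (-(n + 1) * j * j) (by simp [Bn]) (by simp [Bn])
    (by simp [Bn]; linear_combination (-(2 * n + 2) * j * j : ℤ) * hσσ)
    ![t * σ, t * m, 0, 0, 0, 0, a] using 1
  ext i; fin_cases i <;> simp [Bn]
  · linear_combination (-(a * (σ * j))) * hd
  · linear_combination hj - t * j * hσσ

theorem isPrimitiveVec_of_isUnit_apply {v : Fin 7 → ℤ} {i : Fin 7} (hv : IsUnit (v i)) :
    IsPrimitiveVec v := by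
  intro m w hw
  rw [hw] at hv
  exact isUnit_of_mul_isUnit_left hv

/-- The residue `c` modulo `t` is recovered from `β = c · (2n+2)/t`. -/
theorem exists_ediv_gcd_eq {n : ℕ} {t c : ℤ} (ht : 0 < t) (htd : t ∣ 2 * n + 2) (hc : 0 ≤ c)
    (hct : 2 * c ≤ t) (hcop : IsCoprime c t) :
    ∃ β : ℤ, 0 ≤ β ∧ β ≤ (n : ℤ) + 1 ∧ β / (Int.gcd β (2 * (n : ℤ) + 2) : ℤ) = c := by
  obtain ⟨d, hd⟩ := htd
  have hdpos : 0 < d := by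
    by_contra! hle
    nlinarith
  refine ⟨c * d, by positivity, by nlinarith, ?_⟩
  rw [hd, Int.gcd_mul_right, Int.isCoprime_iff_gcd_eq_one.mp hcop, one_mul,
    Int.natAbs_of_nonneg hdpos.le, Int.mul_ediv_cancel _ hdpos.ne']

/-- Every primitive vector `h` of `L_n = U³ ⊕ ⟨-2(n+1)⟩` with divisibility `t` can be
brought into the normal form `t·H − (β/m)·δ`, with `H` a primitive vector of the `U³`
summand, `0 ≤ β ≤ n+1` and `m = gcd(β, 2n+2)`, by an isometry `g` of `L_n` of
determinant `ε ∈ {1,−1}` acting as multiplication by `ε` on the discriminant group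
(so that `det(g)·χ(g) = 1`, i.e. `g` is a monodromy operator).  The action on the
discriminant group `A_{L_n} = L_n^∨/L_n` is expressed via the identification of
`L_n^∨` with `Hom(L_n, ℤ)`: `g` acts by `ε` iff for every functional `φ` the
functional `φ ∘ g − ε·φ` is of the form `B(w, ·)` for some `w ∈ L_n`. -/
theorem normal_form_of_primitive_class
    (n : ℕ) (hn : 1 ≤ n)
    (h : Fin 7 → ℤ) (hprim : IsPrimitiveVec h)
    (t : ℕ) (ht : IsDivisibilityOf n t h) :
    ∃ ε : ℤ, (ε = 1 ∨ ε = -1) ∧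
      ∃ g : (Fin 7 → ℤ) ≃ₗ[ℤ] (Fin 7 → ℤ),
        (∀ x y, Bn n (g x) (g y) = Bn n x y) ∧
        LinearMap.det (g.toLinearMap) = ε ∧
        (∀ φ : Module.Dual ℤ (Fin 7 → ℤ), ∃ w, ∀ y, φ (g y) - ε * φ y = Bn n w y) ∧
        ∃ H : Fin 7 → ℤ, H 6 = 0 ∧ IsPrimitiveVec H ∧
          ∃ β : ℤ, 0 ≤ β ∧ β ≤ (n : ℤ) + 1 ∧
            g h = (t : ℤ) • H - (β / (Int.gcd β (2 * (n : ℤ) + 2) : ℤ)) • deltaLn := by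
  obtain ⟨σ, m, a, hσ, hcop, htd, e⟩ := exists_stablyEquivalent_divisibility hprim ht
  have htpos : (0 : ℤ) < t := by exact_mod_cast ht.1
  have hnonneg := Int.emod_nonneg (-a) htpos.ne'
  have hlt := Int.emod_lt_of_pos (-a) htpos
  have hdvd : (t : ℤ) ∣ -a - -a % t := Int.dvd_self_sub_emod
  generalize -a % (t : ℤ) = c at hnonneg hlt hdvd
  obtain ⟨b, hb⟩ := hdvd
  have hcopc : IsCoprime c t := by
    have : c = -(a + t * b) := by linarith
    rw [this]
    exact ((IsCoprime.add_mul_left_right hcop b).neg_right).symm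
  rcases le_or_gt (2 * c) t with hc | hc
  · obtain ⟨m', e'⟩ := exists_stablyEquivalent_shift (m := m) (a := a) (a' := -c) n hσ htd
      ⟨b, by linarith⟩
    obtain ⟨g, hg, hdet, hdisc, hgh⟩ := e.trans e'
    obtain ⟨β, hβ₀, hβ₁, hβ⟩ := exists_ediv_gcd_eq htpos htd hnonneg hc hcopc
    refine ⟨1, .inl rfl, g, hg, hdet, by simpa only [one_mul] using hdisc,
      ![σ, m', 0, 0, 0, 0, 0], by simp, isPrimitiveVec_of_isUnit_apply (i := 0) (by simpa using hσ),
      β, hβ₀, hβ₁, ?_⟩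
    rw [hβ, hgh]
    ext i; fin_cases i <;> simp [deltaLn]
  · obtain ⟨m', e'⟩ := exists_stablyEquivalent_shift (m := m) (a := a) (a' := t - c) n hσ htd
      ⟨b + 1, by linarith⟩
    obtain ⟨g, hg, hdet, hdisc, hgh⟩ := e.trans e'
    obtain ⟨β, hβ₀, hβ₁, hβ⟩ := exists_ediv_gcd_eq (c := t - c) htpos htd (by linarith)
      (by linarith) (by simpa [sub_eq_neg_add] using hcopc.neg_left.add_mul_left_left 1)
    refine ⟨-1, .inr rfl, g.trans (LinearEquiv.neg ℤ), fun x y => ?_, ?_, fun φ => ?_,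
      ![-σ, -m', 0, 0, 0, 0, 0], by simp, isPrimitiveVec_of_isUnit_apply (i := 0)
        (by simpa using hσ), β, hβ₀, hβ₁, ?_⟩
    · rw [← hg x y]
      simp [Bn]
    · have : (g.trans (LinearEquiv.neg ℤ)).toLinearMap = (-1 : ℤ) • g.toLinearMap := by
        ext; simp
      rw [this, LinearMap.det_smul, hdet]
      norm_num
    · obtain ⟨w, hw⟩ := hdisc φ
      refine ⟨(-1 : ℤ) • w, fun y => ?_⟩
      rw [Bn_smul_left, ← hw y]
      simp
      ring
    · rw [hβ, LinearEquiv.trans_apply, hgh]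
      ext i; fin_cases i <;> simp [deltaLn]
end

section
/- (Eichler's criterion.) Let L' be an even integral lattice and let L = U² ⊕ L'. Let v, w ∈ L be two primitive vectors such that B(v,v) = B(w,w) and such that [v/div(v)] = [w/div(w)] in the discriminant group A_L. Then there exists an isometry g of L of determinant one which induces the identity on A_L and satisfies g(v) = w. -/
/-- The bilinear form of the lattice `U²` realized on `Fin 4 → ℤ`:
coordinates (0,1) and (2,3) span two hyperbolic planes. -/
def BU2 (x y : Fin 4 → ℤ) : ℤ :=
  x 0 * y 1 + x 1 * y 0 + x 2 * y 3 + x 3 * y 2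

namespace LatticeForm

variable {M : Type*} [AddCommGroup M]

/-- The isometries of determinant one that act trivially on the discriminant group. -/
def discriminantKernel (B : LinearMap.BilinForm ℤ M) : Subgroup (M ≃ₗ[ℤ] M) where
  carrier := {g | (∀ x y, B (g x) (g y) = B x y) ∧ LinearEquiv.det g = 1 ∧
    ∀ φ : Module.Dual ℤ M, ∃ u, ∀ y, φ (g y) - φ y = B u y}
  one_mem' := ⟨fun _ _ => rfl, map_one _, fun _ => ⟨0, fun _ => by simp⟩⟩
  mul_mem' := by
    rintro g h ⟨hg, hg', hgφ⟩ ⟨hh, hh', hhφ⟩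
    refine ⟨fun x y => by simp [hg, hh], by rw [map_mul, hg', hh', one_mul], fun φ => ?_⟩
    obtain ⟨u, hu⟩ := hgφ φ
    obtain ⟨u', hu'⟩ := hhφ φ
    refine ⟨h.symm u + u', fun y => ?_⟩
    have key : B (h.symm u) y = B u (h y) := by
      rw [← hh (h.symm u) y, LinearEquiv.apply_symm_apply]
    rw [map_add, LinearMap.add_apply, key, ← hu, ← hu', LinearEquiv.mul_apply]
    ring
  inv_mem' := by
    rintro g ⟨hg, hg', hgφ⟩
    refine ⟨fun x y => ?_, by rw [map_inv, hg', inv_one], fun φ => ?_⟩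
    · rw [← hg (g⁻¹ x) (g⁻¹ y)]
      exact congrArg₂ (fun a b => B a b) (g.apply_symm_apply x) (g.apply_symm_apply y)
    · obtain ⟨u, hu⟩ := hgφ φ
      refine ⟨-g u, fun y => ?_⟩
      obtain ⟨z, rfl⟩ := g.surjective y
      have hz : g⁻¹ (g z) = z := g.symm_apply_apply z
      rw [map_neg, LinearMap.neg_apply, hg, ← hu, hz]
      ring

variable {B : LinearMap.BilinForm ℤ M}

/-- The Eichler transvection of an isotropic vector `e` and a vector `a` orthogonal to `e`. -/
theorem exists_eichler_transvection (hs : ∀ x y, B x y = B y x) {e a : M} {q : ℤ}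
    (he : B e e = 0) (hea : B e a = 0) (hq : B a a = 2 * q) :
    ∃ g ∈ discriminantKernel B,
      ∀ x, g x = x - B a x • e + B e x • a - (q * B e x) • e := by
  have hae : (-B a) e = 0 := by rw [LinearMap.neg_apply, hs, hea, neg_zero]
  have hec : B e (a + q • e) = 0 := by simp [he, hea]
  have hg : ∀ x, (LinearEquiv.transvection hae * LinearEquiv.transvection hec) x =
      x - B a x • e + B e x • a - (q * B e x) • e := by
    intro x
    simp only [LinearEquiv.mul_apply, LinearEquiv.transvection.apply, LinearMap.neg_apply,
      map_add, map_smul, hq, hs a e, hea]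
    module
  refine ⟨_, ⟨fun x y => ?_, by simp, fun φ => ⟨-φ e • a + (φ a - q * φ e) • e, fun y => ?_⟩⟩, hg⟩
  · simp only [hg, map_add, map_sub, map_smul, LinearMap.add_apply, LinearMap.sub_apply,
      LinearMap.smul_apply, smul_eq_mul, he, hea, hs a e, hq, hs x e, hs x a]
    ring
  · simp only [hg, map_add, map_sub, map_smul, LinearMap.add_apply,
      LinearMap.smul_apply, smul_eq_mul]
    ring

/-- An element of the discriminant kernel moves a vector by a multiple of its divisibility. -/
theorem exists_smul_eq_sub_of_mem (hnd : ∀ x, (∀ y, B x y = 0) → x = 0)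
    {g : M ≃ₗ[ℤ] M} (hg : g ∈ discriminantKernel B) {v : M} {d : ℤ} (hd : d ≠ 0)
    (hdv : ∀ y, d ∣ B v y) : ∃ u, g v - v = d • u := by
  choose f hf using hdv
  let φ : Module.Dual ℤ M :=
    { toFun := f
      map_add' := fun x y => by
        apply mul_left_cancel₀ hd
        rw [mul_add, ← hf, ← hf, ← hf, map_add]
      map_smul' := fun c x => by
        apply mul_left_cancel₀ hd
        rw [← hf, map_smul, hf, smul_eq_mul, RingHom.id_apply, smul_eq_mul]
        ring }
  obtain ⟨u, hu⟩ := hg.2.2 φ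
  refine ⟨-g u, sub_eq_zero.mp (hnd _ fun y => ?_)⟩
  obtain ⟨z, rfl⟩ := g.surjective y
  have hz : f (g z) - f z = B u z := hu z
  simp only [map_sub, map_smul, map_neg, LinearMap.sub_apply, LinearMap.smul_apply,
    LinearMap.neg_apply, hg.1, smul_eq_mul]
  rw [hf (g z), hf z, ← hz]
  ring

/-- If `v/s - w/t` is integral and `v` is primitive, then `s` divides `t`. -/
theorem dvd_of_smul_sub_smul {v w u : M} {s t : ℤ} (hv : IsPrimitiveVec v) (hs : s ≠ 0)
    (h : t • v - s • w = (s * t) • u) [Module.IsTorsionFree ℤ M] : s ∣ t := by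
  obtain ⟨a, ha⟩ := Int.gcd_dvd_left s t
  obtain ⟨b, hb⟩ := Int.gcd_dvd_right s t
  have hg : (Int.gcd s t : ℤ) ≠ 0 := fun h0 => hs (by rw [ha, h0, zero_mul])
  generalize hgg : (Int.gcd s t : ℤ) = g at *
  have hbez : a * Int.gcdA s t + b * Int.gcdB s t = 1 := by
    apply mul_left_cancel₀ hg
    have := Int.gcd_eq_gcd_ab s t
    rw [hgg] at this
    rw [mul_add, ← mul_assoc, ← mul_assoc, ← ha, ← hb, ← this, mul_one]
  have hbv : b • v = a • (w + t • u) := by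
    apply smul_right_injective M hg
    change g • b • v = g • a • (w + t • u)
    rw [smul_smul, smul_smul, ← ha, ← hb, sub_eq_iff_eq_add.mp h]
    module
  have hva : v = a • (Int.gcdA s t • v + Int.gcdB s t • (w + t • u)) := by
    calc v = (a * Int.gcdA s t + b * Int.gcdB s t) • v := by rw [hbez, one_smul]
      _ = (a * Int.gcdA s t) • v + Int.gcdB s t • b • v := by module
      _ = _ := by rw [hbv]; module
  have hau := hv _ _ hva
  rw [ha, hb]
  exact mul_dvd_mul_left _ hau.dvd

/-- The vectors `e`, `f` span a hyperbolic plane. -/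
structure IsHyperbolicPair (B : LinearMap.BilinForm ℤ M) (e f : M) : Prop where
  left : B e e = 0
  right : B f f = 0
  pair : B e f = 1

/-- Two vectors orthogonal to a hyperbolic plane, of equal norm, the same divisibility `d` and
congruent modulo `d`, are conjugate under the discriminant kernel. -/
theorem exists_mem_of_orthogonal (hs : ∀ x y, B x y = B y x) (heven : ∀ x, 2 ∣ B x x)
    {e f : M} (hef : IsHyperbolicPair B e f) {v w u x y : M} {d : ℤ} (hd : d ≠ 0)
    (hev : B e v = 0) (hfv : B f v = 0) (hew : B e w = 0) (hfw : B f w = 0)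
    (hx : B v x = d) (hy : B w y = d) (hvw : w - v = d • u) (hsq : B v v = B w w) :
    ∃ g ∈ discriminantKernel B, g v = w := by
  have hfe : B f e = 1 := by rw [hs, hef.pair]
  have move : ∀ {z t : M}, B e z = 0 → B f z = 0 → B z t = d →
      ∃ g ∈ discriminantKernel B, g z = z - d • e := by
    intro z t hez hfz hzt
    set a := t - B f t • e - B e t • f with ha
    have hea : B e a = 0 := by simp [ha, hef.left, hef.pair]
    have haz : B a z = d := by simp [ha, hez, hfz, hs t z, hzt]
    obtain ⟨q, hq⟩ := heven a
    obtain ⟨g, hg, hgx⟩ := exists_eichler_transvection hs hef.left hea hq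
    exact ⟨g, hg, by simp [hgx, hez, haz]⟩
  obtain ⟨g₁, hg₁, hg₁v⟩ := move hev hfv hx
  obtain ⟨g₂, hg₂, hg₂w⟩ := move hew hfw hy
  have hfu : B f (-u) = 0 := by
    apply mul_left_cancel₀ hd
    have := congrArg (B f) hvw
    rw [map_sub, map_smul, hfv, hfw, smul_eq_mul] at this
    rw [map_neg]
    linarith
  obtain ⟨q, hq⟩ := heven (-u)
  obtain ⟨g₃, hg₃, hg₃x⟩ := exists_eichler_transvection hs hef.right hfu hq
  obtain ⟨c, hc⟩ : ∃ c : ℤ, g₃ (v - d • e) = w - d • e + c • f := by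
    refine ⟨-B (-u) (v - d • e) + q * d, ?_⟩
    rw [hg₃x, map_sub (B f), map_smul, hfv, hfe, sub_eq_iff_eq_add.mp hvw, smul_eq_mul]
    module
  have hc0 : c = 0 := by
    have h := hg₃.1 (v - d • e) (v - d • e)
    rw [hc] at h
    simp only [map_add, map_sub, map_smul, LinearMap.add_apply, LinearMap.sub_apply,
      LinearMap.smul_apply, smul_eq_mul, hs v e, hs w e, hs w f, hev, hew, hfw,
      hef.left, hef.right, hef.pair, hfe, hsq] at h
    have : d * c = 0 := by linarith
    exact (mul_eq_zero.mp this).resolve_left hd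
  refine ⟨g₂⁻¹ * g₃ * g₁, mul_mem (mul_mem (inv_mem hg₂) hg₃) hg₁, ?_⟩
  rw [LinearEquiv.mul_apply, LinearEquiv.mul_apply, hg₁v, hc, hc0, zero_smul, add_zero, ← hg₂w]
  exact g₂.symm_apply_apply w

/-- The transvection attached to two orthogonal isotropic vectors. -/
theorem exists_isotropic_transvection (hs : ∀ x y, B x y = B y x) {e a : M}
    (he : B e e = 0) (ha : B a a = 0) (hea : B e a = 0) (k : ℤ) :
    ∃ g ∈ discriminantKernel B, ∀ x, g x = x - (k * B a x) • e + (k * B e x) • a := by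
  obtain ⟨g, hg, hgx⟩ := exists_eichler_transvection (a := k • a) (q := 0) hs he
    (by simp [hea]) (by simp [ha])
  refine ⟨g, hg, fun x => ?_⟩
  rw [hgx, map_smul, LinearMap.smul_apply, smul_eq_mul]
  module

/-- In the presence of two orthogonal hyperbolic planes, every vector can be moved by the
discriminant kernel into the orthogonal complement of the first one. -/
theorem exists_mem_orthogonal (hs : ∀ x y, B x y = B y x) {e f e' f' : M}
    (hef : IsHyperbolicPair B e f) (hef' : IsHyperbolicPair B e' f')
    (hee' : B e e' = 0) (hef₁ : B e f' = 0) (hfe₁ : B f e' = 0) (hff' : B f f' = 0) (v : M) :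
    ∃ g ∈ discriminantKernel B, B e (g v) = 0 ∧ B f (g v) = 0 := by
  have hfe : B f e = 1 := by rw [hs, hef.pair]
  have hfe' : B f' e' = 1 := by rw [hs, hef'.pair]
  have he'e : B e' e = 0 := by rw [hs, hee']
  have he'f : B e' f = 0 := by rw [hs, hfe₁]
  have hf'e : B f' e = 0 := by rw [hs, hef₁]
  have hf'f : B f' f = 0 := by rw [hs, hff']
  -- a transvection along the second plane shifts one of its coordinates
  have raise : ∀ {p : M}, (p = e ∨ p = f) → ∀ g ∈ discriminantKernel B, ∀ k : ℤ,
      ∃ h ∈ discriminantKernel B, B f' (h v) = B f' (g v) + k * B p (g v) := by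
    intro p hp g hg k
    have hpp : B p p = 0 := by rcases hp with rfl | rfl; exacts [hef.left, hef.right]
    have hpe' : B p e' = 0 := by rcases hp with rfl | rfl; exacts [hee', hfe₁]
    have hf'p : B f' p = 0 := by rcases hp with rfl | rfl; exacts [hf'e, hf'f]
    obtain ⟨h, hh, hhx⟩ := exists_isotropic_transvection hs hpp hef'.left hpe' k
    exact ⟨h * g, mul_mem hh hg, by simp [hhx, hf'p, hfe']⟩
  by_cases hall : ∀ g ∈ discriminantKernel B, B f' (g v) = 0
  · refine ⟨1, one_mem _, ?_, ?_⟩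
    · obtain ⟨h, hh, hhv⟩ := raise (Or.inl rfl) 1 (one_mem _) 1
      rw [hall h hh, hall 1 (one_mem _)] at hhv
      linarith
    · obtain ⟨h, hh, hhv⟩ := raise (Or.inr rfl) 1 (one_mem _) 1
      rw [hall h hh, hall 1 (one_mem _)] at hhv
      linarith
  push Not at hall
  let P : ℕ → Prop := fun n =>
    ∃ g ∈ discriminantKernel B, B f' (g v) ≠ 0 ∧ (B f' (g v)).natAbs = n
  have hP : ∃ n, P n := by
    obtain ⟨g, hg, hgv⟩ := hall
    exact ⟨_, g, hg, hgv, rfl⟩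
  classical
  obtain ⟨g, hg, hgv, hgn⟩ := Nat.find_spec hP
  have hmin : ∀ h ∈ discriminantKernel B, B f' (h v) ≠ 0 →
      (B f' (g v)).natAbs ≤ (B f' (h v)).natAbs := fun h hh hhv => by
    rw [hgn]
    exact Nat.find_min' hP ⟨h, hh, hhv, rfl⟩
  set n := B f' (g v) with hn
  -- minimality forces a reduced coordinate to vanish
  have vanish : ∀ {p : M}, (p = e ∨ p = f) → ∀ h ∈ discriminantKernel B, B f' (h v) = n →
      0 ≤ B p (h v) → B p (h v) < |n| → B p (h v) = 0 := by
    intro p hp h hh hhn h0 hlt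
    by_contra hne
    obtain ⟨h', hh', hhv'⟩ := raise hp h hh (-((n - 1) / B p (h v)))
    have hmod := Int.emod_add_mul_ediv (n - 1) (B p (h v))
    have hval : B f' (h' v) = (n - 1) % B p (h v) + 1 := by
      rw [hhv', hhn]; linarith
    have h1 := Int.emod_nonneg (n - 1) hne
    have h2 := Int.emod_lt_of_pos (n - 1) (lt_of_le_of_ne h0 (Ne.symm hne))
    have := hmin h' hh' (by rw [hval]; omega)
    rw [hval, ← Int.ofNat_le, Int.natCast_natAbs, Int.natCast_natAbs,
      abs_of_nonneg (by omega : 0 ≤ (n - 1) % B p (h v) + 1)] at this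
    omega
  obtain ⟨h₁, hh₁, hx₁⟩ := exists_isotropic_transvection hs hef.left hef'.right hef₁ (B f (g v) / n)
  obtain ⟨h₂, hh₂, hx₂⟩ := exists_isotropic_transvection hs hef.right hef'.right hff' (B e (g v) / n)
  have hmem : h₂ * h₁ * g ∈ discriminantKernel B := mul_mem (mul_mem hh₂ hh₁) hg
  have hval : B f' ((h₂ * h₁ * g) v) = n := by
    simp [hx₁, hx₂, hf'e, hf'f, hef'.right, hn]
  have hvale : B e ((h₂ * h₁ * g) v) = B e (g v) % n := by
    rw [Int.emod_def]
    simp [hx₁, hx₂, hf'e, hef'.right, hef.left, hef.pair, hef₁, ← hn]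
    ring
  have hvalf : B f ((h₂ * h₁ * g) v) = B f (g v) % n := by
    rw [Int.emod_def]
    simp [hx₁, hx₂, hf'e, hef'.right, hef.right, hfe, hff', ← hn]
    ring
  refine ⟨_, hmem, vanish (Or.inl rfl) _ hmem hval ?_ ?_, vanish (Or.inr rfl) _ hmem hval ?_ ?_⟩
  · rw [hvale]; exact Int.emod_nonneg _ hgv
  · rw [hvale]; exact Int.emod_lt_abs _ hgv
  · rw [hvalf]; exact Int.emod_nonneg _ hgv
  · rw [hvalf]; exact Int.emod_lt_abs _ hgv

/-- The divisibility of a vector is attained as a value of the form. -/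
theorem exists_apply_eq_of_forall_dvd {v : M} {d : ℤ}
    (hd : ∀ s : ℤ, (∀ y, s ∣ B v y) → s ∣ d) : ∃ x, B v x = d := by
  obtain ⟨s, hs⟩ := (IsPrincipalIdealRing.principal (LinearMap.range (B v))).principal
  have hsd : s ∣ d := hd s fun y => by
    have hy := LinearMap.mem_range_self (B v) y
    rw [hs] at hy
    exact Ideal.mem_span_singleton.mp hy
  have : d ∈ LinearMap.range (B v) := by
    rw [hs]
    exact Ideal.mem_span_singleton.mpr hsd
  exact this

/-- Eichler's criterion for an even lattice containing two orthogonal hyperbolic planes. -/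
theorem exists_mem_discriminantKernel (hs : ∀ x y, B x y = B y x) (heven : ∀ x, 2 ∣ B x x)
    (hnd : ∀ x, (∀ y, B x y = 0) → x = 0) {e f e' f' : M}
    (hef : IsHyperbolicPair B e f) (hef' : IsHyperbolicPair B e' f')
    (hee' : B e e' = 0) (hef₁ : B e f' = 0) (hfe₁ : B f e' = 0) (hff' : B f f' = 0)
    {v w u x y : M} {d : ℤ} (hd : d ≠ 0) (hdv : ∀ y, d ∣ B v y) (hdw : ∀ y, d ∣ B w y)
    (hx : B v x = d) (hy : B w y = d) (hvw : w - v = d • u) (hsq : B v v = B w w) :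
    ∃ g ∈ discriminantKernel B, g v = w := by
  obtain ⟨g, hg, hgv⟩ := exists_mem_orthogonal hs hef hef' hee' hef₁ hfe₁ hff' v
  obtain ⟨h, hh, hhw⟩ := exists_mem_orthogonal hs hef hef' hee' hef₁ hfe₁ hff' w
  obtain ⟨a, ha⟩ := exists_smul_eq_sub_of_mem hnd hg hd hdv
  obtain ⟨b, hb⟩ := exists_smul_eq_sub_of_mem hnd hh hd hdw
  obtain ⟨k, hk, hkv⟩ := exists_mem_of_orthogonal (x := g x) (y := h y) (u := b + u - a) hs heven
    hef hd hgv.1 hgv.2 hhw.1 hhw.2 (by rw [hg.1, hx]) (by rw [hh.1, hy])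
    (by rw [smul_sub, smul_add, ← ha, ← hb, ← hvw]; abel) (by rw [hg.1, hh.1, hsq])
  refine ⟨h⁻¹ * k * g, mul_mem (mul_mem (inv_mem hh) hk) hg, ?_⟩
  rw [LinearEquiv.mul_apply, LinearEquiv.mul_apply, hkv]
  exact h.symm_apply_apply w

end LatticeForm

open LatticeForm

/-- **Eichler's criterion.**  Let `L'` be an even (nondegenerate, finitely generated
free) integral lattice and `L = U² ⊕ L'` (realized as `(Fin 4 → ℤ) × L'` with the
orthogonal sum form `BB`).  If `v, w ∈ L` are primitive vectors with `B(v,v) = B(w,w)`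
whose classes `[v/div(v)]` and `[w/div(w)]` agree in the discriminant group `A_L`
(i.e. the integral functional `y ↦ B(v,y)/div(v) − B(w,y)/div(w)` is of the form
`B(u,·)` for some `u ∈ L`), then there is an isometry `g` of `L` of determinant one,
inducing the identity on `A_L` (i.e. `φ ∘ g − φ` is of the form `B(u,·)` for every
functional `φ`), with `g(v) = w`. -/
theorem eichler_criterion
    (L' : Type*) [AddCommGroup L'] [Module ℤ L'] [Module.Free ℤ L'] [Module.Finite ℤ L']
    (B' : L' → L' → ℤ)
    (hadd : ∀ x x' y, B' (x + x') y = B' x y + B' x' y)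
    (hsmul : ∀ (c : ℤ) (x y : L'), B' (c • x) y = c * B' x y)
    (hsymm : ∀ x y, B' x y = B' y x)
    (hnd : ∀ x, (∀ y, B' x y = 0) → x = 0)
    (heven : ∀ x, 2 ∣ B' x x)
    (BB : (Fin 4 → ℤ) × L' → (Fin 4 → ℤ) × L' → ℤ)
    (hBB : ∀ p q, BB p q = BU2 p.1 q.1 + B' p.2 q.2)
    (v w : (Fin 4 → ℤ) × L')
    (hv : IsPrimitiveVec v) (hw : IsPrimitiveVec w)
    (hsq : BB v v = BB w w)
    (tv tw : ℕ)
    (htv : 0 < tv ∧ (∀ y, (tv : ℤ) ∣ BB v y) ∧ ∀ s : ℤ, (∀ y, s ∣ BB v y) → s ∣ (tv : ℤ))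
    (htw : 0 < tw ∧ (∀ y, (tw : ℤ) ∣ BB w y) ∧ ∀ s : ℤ, (∀ y, s ∣ BB w y) → s ∣ (tw : ℤ))
    (hclass : ∃ u, ∀ y, BB v y / (tv : ℤ) - BB w y / (tw : ℤ) = BB u y) :
    ∃ g : ((Fin 4 → ℤ) × L') ≃ₗ[ℤ] ((Fin 4 → ℤ) × L'),
      (∀ x y, BB (g x) (g y) = BB x y) ∧
      LinearMap.det (g.toLinearMap) = 1 ∧
      (∀ φ : Module.Dual ℤ ((Fin 4 → ℤ) × L'), ∃ u, ∀ y, φ (g y) - φ y = BB u y) ∧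
      g v = w := by
  obtain rfl : ‹Module ℤ L'› = AddCommGroup.toIntModule L' := Subsingleton.elim _ _
  have hadd' : ∀ x y y', B' x (y + y') = B' x y + B' x y' := fun x y y' => by
    rw [hsymm, hadd, hsymm y, hsymm y']
  have hsmul' : ∀ (c : ℤ) (x y : L'), B' x (c • y) = c * B' x y := fun c x y => by
    rw [hsymm, hsmul, hsymm y]
  have hzero : ∀ y, B' 0 y = 0 := fun y => by simpa using hsmul 0 0 y
  let B : LinearMap.BilinForm ℤ ((Fin 4 → ℤ) × L') := LinearMap.mk₂ ℤ BB
    (fun x x' y => by simp only [hBB, BU2, Prod.fst_add, Prod.snd_add, Pi.add_apply, hadd]; ring)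
    (fun c x y => by
      simp only [hBB, BU2, Prod.smul_fst, Prod.smul_snd, Pi.smul_apply, hsmul, smul_eq_mul]; ring)
    (fun x y y' => by
      simp only [hBB, BU2, Prod.fst_add, Prod.snd_add, Pi.add_apply, hadd']; ring)
    (fun c x y => by
      simp only [hBB, BU2, Prod.smul_fst, Prod.smul_snd, Pi.smul_apply, hsmul', smul_eq_mul]; ring)
  have hB : ∀ x y, B x y = BB x y := fun _ _ => rfl
  have hs : ∀ x y, B x y = B y x := fun x y => by
    rw [hB, hB, hBB, hBB, hsymm]; simp only [BU2]; ring
  have hev : ∀ x, 2 ∣ B x x := fun x => by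
    rw [hB, hBB]
    refine dvd_add ⟨x.1 0 * x.1 1 + x.1 2 * x.1 3, ?_⟩ (heven _)
    simp only [BU2]; ring
  let b : Fin 4 → (Fin 4 → ℤ) × L' := fun i => (Pi.single i 1, 0)
  have hb : ∀ i x, B (b i) x = BU2 (Pi.single i 1) x.1 := fun i x => by
    rw [hB, hBB, hzero, add_zero]
  have hnd' : ∀ x, (∀ y, B x y = 0) → x = 0 := by
    intro x hx
    have hx' : ∀ i, BU2 (Pi.single i 1) x.1 = 0 := fun i => by rw [← hb, hs, hx]
    refine Prod.ext (funext fun i => ?_) (hnd _ fun y => ?_)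
    · have h0 := hx' 0
      have h1 := hx' 1
      have h2 := hx' 2
      have h3 := hx' 3
      simp [BU2] at h0 h1 h2 h3
      fin_cases i <;> simpa
    · simpa [hB, hBB, BU2] using hx (0, y)
  obtain ⟨htv0, htvd, htvs⟩ := htv
  obtain ⟨htw0, htwd, htws⟩ := htw
  have hv0 : (tv : ℤ) ≠ 0 := by omega
  have hw0 : (tw : ℤ) ≠ 0 := by omega
  obtain ⟨u, hu⟩ := hclass
  have hrel : (tw : ℤ) • v - (tv : ℤ) • w = ((tv : ℤ) * tw) • u := by
    refine sub_eq_zero.mp (hnd' _ fun y => ?_)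
    simp only [map_sub, map_smul, LinearMap.sub_apply, LinearMap.smul_apply, smul_eq_mul, hB, ← hu]
    obtain ⟨p, hp⟩ := htvd y
    obtain ⟨r, hr⟩ := htwd y
    rw [hp, hr, Int.mul_ediv_cancel_left _ hv0, Int.mul_ediv_cancel_left _ hw0]
    ring
  have htt : tv = tw := by
    refine Nat.dvd_antisymm ?_ ?_ <;> rw [← Int.natCast_dvd_natCast]
    · exact dvd_of_smul_sub_smul hv hv0 hrel
    · refine dvd_of_smul_sub_smul (w := v) (u := -u) hw hw0 ?_
      rw [← neg_sub, hrel]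
      module
  subst htt
  obtain ⟨x, hx⟩ := exists_apply_eq_of_forall_dvd (B := B) htvs
  obtain ⟨y, hy⟩ := exists_apply_eq_of_forall_dvd (B := B) htws
  have hvw : w - v = (tv : ℤ) • -u := by
    apply smul_right_injective _ hv0
    change (tv : ℤ) • (w - v) = (tv : ℤ) • (tv : ℤ) • -u
    rw [← neg_sub v w, smul_neg, smul_sub, hrel]
    module
  obtain ⟨g, hg, hgv⟩ := exists_mem_discriminantKernel (e := b 0) (f := b 1) (e' := b 2)
    (f' := b 3) hs hev hnd' ⟨by simp [hb, b, BU2], by simp [hb, b, BU2], by simp [hb, b, BU2]⟩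
    ⟨by simp [hb, b, BU2], by simp [hb, b, BU2], by simp [hb, b, BU2]⟩
    (by simp [hb, b, BU2]) (by simp [hb, b, BU2]) (by simp [hb, b, BU2]) (by simp [hb, b, BU2])
    hv0 htvd htwd hx hy hvw hsq
  refine ⟨g, hg.1, ?_, hg.2.2, hgv⟩
  rw [← LinearEquiv.coe_det, hg.2.1, Units.val_one]
end

section
/- Let Λ be an even unimodular integral lattice, let v ∈ Λ be a primitive vector with B(v,v) ≠ 0, and let L = v^⊥ = {x ∈ Λ : B(x,v) = 0} with the restricted bilinear form. Let ε ∈ {1, −1} and let g be an isometry of L which induces multiplication by ε on the discriminant group A_L. Then g extends to an isometry g̃ of Λ with g̃(x) = g(x) for all x ∈ L and g̃(v) = ε·v (so in particular det(g̃) = ε·det(g)). (This is the extension step in the proof that f_{v,X} is a monodromy invariant, Lemma 3.2.) -/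
/-- If `c` is the scalar by which `e` acts on `M / ker f` for a surjective functional `f`, then
`det e` is `c` times the determinant of the restriction of `e` to `ker f`. -/
theorem det_eq_mul_det_of_ker {R M : Type*} [CommRing R] [IsDomain R] [IsPrincipalIdealRing R]
    [AddCommGroup M] [Module R M] [Module.Free R M] [Module.Finite R M]
    {f : M →ₗ[R] R} (hf : Function.Surjective f) {c : R} {e : M →ₗ[R] M}
    (he : ∀ x, f (e x) = c * f x) {g : LinearMap.ker f →ₗ[R] LinearMap.ker f}
    (hg : ∀ x : LinearMap.ker f, e x = g x) :
    LinearMap.det e = c * LinearMap.det g := by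
  have hle : LinearMap.ker f ≤ (LinearMap.ker f).comap e := fun x hx => by
    simp [he, LinearMap.mem_ker.1 hx]
  let q := f.quotKerEquivOfSurjective hf
  have : Module.Free R (M ⧸ LinearMap.ker f) := Module.Free.of_equiv q.symm
  have hrestrict : e.restrict hle = g := by
    ext x
    simp [hg]
  have hquot : (LinearMap.ker f).mapQ (LinearMap.ker f) e hle = c • LinearMap.id := by
    ext x
    apply q.injective
    simp [q, he]
  have hrank : Module.finrank R (M ⧸ LinearMap.ker f) = 1 := by
    rw [q.finrank_eq, Module.finrank_self]
  rw [LinearMap.det_eq_det_mul_det (LinearMap.ker f) e hle, hrestrict, hquot,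
    LinearMap.det_smul, hrank, LinearMap.det_id, pow_one, mul_one, mul_comm]

/-- In a unimodular lattice, a primitive vector pairs to `1` with some vector. -/
theorem IsPrimitiveVec.exists_pairing_eq_one {Λ : Type*} [AddCommGroup Λ]
    {B : Λ →ₗ[ℤ] Λ →ₗ[ℤ] ℤ} (hnd : ∀ x, (∀ y, B x y = 0) → x = 0)
    (huni : ∀ φ : Module.Dual ℤ Λ, ∃ x, ∀ y, φ y = B x y)
    {v : Λ} (hv : IsPrimitiveVec v) : ∃ w, B v w = 1 := by
  obtain ⟨d, hd⟩ := (IsPrincipalIdealRing.principal (LinearMap.range (B v))).principal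
  have hdvd (y : Λ) : d ∣ B v y := by
    rw [← Ideal.mem_span_singleton, Ideal.span, ← hd]
    exact ⟨y, rfl⟩
  obtain ⟨w, hw⟩ : d ∈ LinearMap.range (B v) := hd ▸ Submodule.mem_span_singleton_self d
  have hunit : IsUnit d := by
    rcases eq_or_ne d 0 with rfl | hd0
    · have hv0 : v = 0 := hnd v fun y => zero_dvd_iff.1 (hdvd y)
      exact hv 0 0 (by rw [hv0, smul_zero])
    · choose φ hφ using hdvd
      let ψ : Module.Dual ℤ Λ :=
        { toFun := φ
          map_add' := fun x y => mul_left_cancel₀ hd0 <| by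
            rw [mul_add, ← hφ, ← hφ, ← hφ, map_add]
          map_smul' := fun a x => mul_left_cancel₀ hd0 <| by
            rw [← hφ, map_smul, hφ, RingHom.id_apply, smul_eq_mul, smul_eq_mul]
            ring }
      obtain ⟨x, hx⟩ := huni ψ
      refine hv d x (sub_eq_zero.1 <| hnd _ fun y => ?_)
      rw [map_sub, map_smul, LinearMap.sub_apply, LinearMap.smul_apply, ← hx, hφ]
      exact sub_self _
  obtain ⟨c, hc⟩ := hunit.exists_left_inv
  exact ⟨c • w, by rw [map_smul, hw, smul_eq_mul, hc]⟩

/-- A vector of `v^⊥` that is orthogonal to `v^⊥` vanishes when `v` is not isotropic. -/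
theorem eq_zero_of_orthogonal_perp {Λ : Type*} [AddCommGroup Λ]
    {B : Λ →ₗ[ℤ] Λ →ₗ[ℤ] ℤ} (hnd : ∀ x, (∀ y, B x y = 0) → x = 0) {v : Λ} (hvv : B v v ≠ 0)
    {d : Λ} (hdv : B d v = 0) (hd : ∀ y : LinearMap.ker (B.flip v), B d y = 0) : d = 0 := by
  refine hnd d fun x => ?_
  have hx : B v v • x - B x v • v ∈ LinearMap.ker (B.flip v) := by
    simp [mul_comm]
  have := hd ⟨_, hx⟩
  simp only [map_sub, map_smul, hdv, smul_eq_mul, mul_zero, sub_zero] at this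
  exact (mul_eq_zero.1 this).resolve_left hvv

/-- Let `Λ` be an even unimodular integral lattice (unimodularity: every integral
functional is of the form `B(x,·)`), `v ∈ Λ` primitive with `B(v,v) ≠ 0`, and
`L = v^⊥` with the restricted form.  If `g` is an isometry of `L` inducing
multiplication by `ε ∈ {1,−1}` on the discriminant group `A_L` (i.e. for every
functional `φ` on `L` the functional `φ ∘ g − ε·φ` is of the form `B(u,·)|_L` for
some `u ∈ L`), then `g` extends to an isometry `g̃` of `Λ` with `g̃|_L = g` and
`g̃(v) = ε·v`, so in particular `det(g̃) = ε·det(g)`. -/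
theorem extension_of_isometry_of_perp
    (Λ : Type*) [AddCommGroup Λ] [Module ℤ Λ] [Module.Free ℤ Λ] [Module.Finite ℤ Λ]
    (B : Λ →ₗ[ℤ] Λ →ₗ[ℤ] ℤ)
    (hsymm : ∀ x y, B x y = B y x)
    (hnd : ∀ x, (∀ y, B x y = 0) → x = 0)
    (heven : ∀ x, 2 ∣ B x x)
    (huni : ∀ φ : Module.Dual ℤ Λ, ∃ x, ∀ y, φ y = B x y)
    (v : Λ) (hvprim : IsPrimitiveVec v) (hvv : B v v ≠ 0)
    (ε : ℤ) (hε : ε = 1 ∨ ε = -1)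
    (g : ↥(LinearMap.ker (B.flip v)) ≃ₗ[ℤ] ↥(LinearMap.ker (B.flip v)))
    (hgisom : ∀ x y : ↥(LinearMap.ker (B.flip v)),
      B (g x : Λ) (g y : Λ) = B (x : Λ) (y : Λ))
    (hgdisc : ∀ φ : Module.Dual ℤ ↥(LinearMap.ker (B.flip v)),
      ∃ u : ↥(LinearMap.ker (B.flip v)), ∀ y : ↥(LinearMap.ker (B.flip v)),
        φ (g y) - ε * φ y = B (u : Λ) (y : Λ)) :
    ∃ gt : Λ ≃ₗ[ℤ] Λ,
      (∀ x y, B (gt x) (gt y) = B x y) ∧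
      (∀ x : ↥(LinearMap.ker (B.flip v)), gt (x : Λ) = (g x : Λ)) ∧
      gt v = ε • v ∧
      LinearMap.det (gt.toLinearMap) = ε * LinearMap.det (g.toLinearMap) := by
  obtain rfl : ‹Module ℤ Λ› = AddCommGroup.toIntModule Λ := Subsingleton.elim _ _
  have hεε : ε * ε = 1 := by rcases hε with rfl | rfl <;> norm_num
  obtain ⟨w, hvw⟩ := hvprim.exists_pairing_eq_one hnd huni
  have hwv : B w v = 1 := by rw [hsymm, hvw]
  have hperp (x : LinearMap.ker (B.flip v)) : B (x : Λ) v = 0 := x.2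
  have hperp' (x : LinearMap.ker (B.flip v)) : B v (x : Λ) = 0 := by rw [hsymm, hperp]
  obtain ⟨u, hu⟩ := hgdisc ((B w).comp (LinearMap.ker (B.flip v)).subtype)
  replace hu (y : LinearMap.ker (B.flip v)) : B w (g y : Λ) - ε * B w (y : Λ) = B (u : Λ) y :=
    hu y
  -- The image of `w` under the extension.
  obtain ⟨w', hw'⟩ : ∃ w' : Λ, w' = ε • (w - (g u : Λ)) := ⟨_, rfl⟩
  have hw'v : B w' v = ε := by simp [hw', hwv, hperp]
  have hw'g (y : LinearMap.ker (B.flip v)) : B w' (g y : Λ) = B w (y : Λ) := by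
    simp only [hw', map_smul, map_sub, LinearMap.smul_apply, LinearMap.sub_apply, smul_eq_mul,
      hgisom]
    linear_combination ε * hu y + B w y * hεε
  let P : Λ →ₗ[ℤ] LinearMap.ker (B.flip v) :=
    (LinearMap.id - (B.flip v).smulRight w).codRestrict _ fun x => by simp [hwv]
  have hP (x : Λ) : (P x : Λ) = x - B x v • w := rfl
  have hPperp (x : LinearMap.ker (B.flip v)) : P x = x := Subtype.ext <| by
    rw [hP, hperp, zero_smul, sub_zero]
  have hnw' : B v v • w' = ε • v - (g (P v) : Λ) := by
    refine sub_eq_zero.1 (eq_zero_of_orthogonal_perp hnd hvv ?_ fun y => ?_)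
    · simp only [map_smul, map_sub, LinearMap.smul_apply, LinearMap.sub_apply, smul_eq_mul,
        hw'v, hperp]
      ring
    · obtain ⟨y, rfl⟩ := g.surjective y
      simp only [map_smul, map_sub, LinearMap.smul_apply, LinearMap.sub_apply, smul_eq_mul,
        hw'g, hgisom, hP, hperp']
      ring
  have hw'w' : B w' w' = B w w := by
    apply mul_left_cancel₀ hvv
    have h := congrArg (B w') hnw'
    simp only [map_smul, map_sub, smul_eq_mul, hw'v, hw'g, hP, hwv] at h
    linear_combination h + hεε
  let T : Λ →ₗ[ℤ] Λ :=
    (LinearMap.ker (B.flip v)).subtype ∘ₗ g.toLinearMap ∘ₗ P + (B.flip v).smulRight w'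
  have hT (x : Λ) : T x = (g (P x) : Λ) + B x v • w' := rfl
  have hTperp (x : LinearMap.ker (B.flip v)) : T x = g x := by
    rw [hT, hPperp, hperp, zero_smul, add_zero]
  have hdet : LinearMap.det T = ε * LinearMap.det g.toLinearMap := by
    refine det_eq_mul_det_of_ker (f := B.flip v) (fun a => ⟨a • w, by simp [hwv]⟩)
      (fun x => ?_) hTperp
    simp [hT, hperp, hw'v, mul_comm]
  have hbij : Function.Bijective T := by
    rw [← Module.End.isUnit_iff, LinearMap.isUnit_iff_isUnit_det, hdet]
    exact (IsUnit.of_mul_eq_one ε hεε).mul g.isUnit_det'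
  refine ⟨LinearEquiv.ofBijective T hbij, fun x y => ?_, hTperp, ?_, hdet⟩
  · have hgw' (z : LinearMap.ker (B.flip v)) : B (g z : Λ) w' = B (z : Λ) w := by
      rw [hsymm, hw'g, hsymm]
    simp only [LinearEquiv.ofBijective_apply, hT, map_add, map_smul, LinearMap.add_apply,
      LinearMap.smul_apply, smul_eq_mul, hgisom, hw'g, hgw', hw'w', hP, map_sub,
      LinearMap.sub_apply]
    ring
  · rw [LinearEquiv.ofBijective_apply, hT, hnw', add_sub_cancel]
end

section
/- Let n ≥ 1 be an integer, let λ, μ be coprime integers, set t = gcd(λ, 2n+2) and m = (2n+2)/t, let d be any integer, and let β be an integer with β ≡ μ·m (mod 2n+2). Then m divides β and 2t² divides 2dλ² − 2μ²(n+1) + (β/m)²·2(n+1). (This is the divisibility assertion in the proof of Lemma 4.1: for h of square h² = 2dλ² − 2(n+1)μ², the quantity h² + (β/m)²·2(n+1) is divisible by 2t², so that one can write h² = t²(2d') − (β/m)²·2(n+1) for an integer d'.) -/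
/-- For coprime `λ, μ`, `t = gcd(λ, 2n+2)`, `m = (2n+2)/t`, any integer `d`, and any
`β ≡ μm (mod 2n+2)`: `m` divides `β`, and `2t²` divides
`2dλ² − 2μ²(n+1) + (β/m)²·2(n+1)`. -/
theorem divisibility_for_square_correction
    (n : ℕ) (hn : 1 ≤ n) (lam mu : ℤ) (hco : IsCoprime lam mu)
    (t m : ℕ) (htdef : t = Int.gcd lam (2 * (n : ℤ) + 2)) (hmdef : m = (2 * n + 2) / t)
    (d β : ℤ) (hβ : β ≡ mu * (m : ℤ) [ZMOD (2 * (n : ℤ) + 2)]) :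
    (m : ℤ) ∣ β ∧
      2 * (t : ℤ) ^ 2 ∣
        2 * d * lam ^ 2 - 2 * mu ^ 2 * ((n : ℤ) + 1) +
          (β / (m : ℤ)) ^ 2 * (2 * ((n : ℤ) + 1)) := by
  have ht_dvd : (t : ℤ) ∣ 2 * (n : ℤ) + 2 := htdef ▸ Int.gcd_dvd_right _ _
  obtain ⟨l, hl⟩ : (t : ℤ) ∣ lam := htdef ▸ Int.gcd_dvd_left _ _
  have htm : (t : ℤ) * m = 2 * n + 2 := by
    rw [hmdef]
    exact_mod_cast Nat.mul_div_cancel' (by exact_mod_cast ht_dvd)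
  have hm : (m : ℤ) ≠ 0 := by
    intro h
    rw [h] at htm
    omega
  obtain ⟨k, hk⟩ := hβ.symm.dvd
  have hβ_eq : β = m * (mu + k * t) := by linear_combination hk - k * htm
  refine ⟨⟨_, hβ_eq⟩, d * l ^ 2 + mu * m * k + k ^ 2 * (n + 1), ?_⟩
  rw [hβ_eq, Int.mul_ediv_cancel_left _ hm, hl]
  linear_combination (-(2 * mu * k * t)) * htm
end
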